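/- Let x = (x_1, …, x_n) ∈ [0,1]^n, fix an index i and a real c with 0 < c ≤ x_i, and let x' be the profile obtained from x by replacing x_i with x_i − c (all other coordinates unchanged). If y* is a Nash optimum for x and y'* is a Nash optimum for x', then y'* ≤ y*. -/

import Mathlib

open Set

noncomputable section

/-- Utility of an agent at location `z` when the facility is at `y`. -/
def util (y z : ℝ) : ℝ := 1 - |y - z|

/-- Nash welfare: product of agents' utilities. -/
def nash {n : ℕ} (y : ℝ) (x : Fin n → ℝ) : ℝ := ∏ i, util y (x i)

/-- `y` is a Nash optimum for the profile `x`. -/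
def isNashOpt {n : ℕ} (x : Fin n → ℝ) (y : ℝ) : Prop :=
  y ∈ Set.Icc (0 : ℝ) 1 ∧ ∀ z ∈ Set.Icc (0 : ℝ) 1, nash z x ≤ nash y x

/-- Strict log-supermodularity of `util` in the facility and agent locations. -/
theorem util_mul_util_lt {a b w z : ℝ} (ha : 0 ≤ a) (hab : a < b) (hb : b ≤ 1)
    (hw : 0 ≤ w) (hwz : w < z) (hz : z ≤ 1) :
    util a z * util b w < util a w * util b z := by
  unfold util
  have h := mul_pos (sub_pos.2 hab) (sub_pos.2 hwz)
  rcases abs_cases (a - z) with ⟨e₁, h₁⟩ | ⟨e₁, h₁⟩ <;>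
  rcases abs_cases (b - w) with ⟨e₂, h₂⟩ | ⟨e₂, h₂⟩ <;>
  rcases abs_cases (a - w) with ⟨e₃, h₃⟩ | ⟨e₃, h₃⟩ <;>
  rcases abs_cases (b - z) with ⟨e₄, h₄⟩ | ⟨e₄, h₄⟩ <;>
  rw [e₁, e₂, e₃, e₄] <;>
  nlinarith

theorem util_nonneg {y z : ℝ} (hy : y ∈ Set.Icc (0 : ℝ) 1) (hz : z ∈ Set.Icc (0 : ℝ) 1) :
    0 ≤ util y z := by
  have : |y - z| ≤ 1 := abs_le.2 ⟨by linarith [hy.1, hz.2], by linarith [hy.2, hz.1]⟩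
  unfold util
  linarith

theorem isNashOpt.nash_pos {n : ℕ} {x : Fin n → ℝ} {y : ℝ} (h : isNashOpt x y)
    (hx : ∀ i, x i ∈ Set.Icc (0 : ℝ) 1) : 0 < nash y x := by
  refine lt_of_lt_of_le (Finset.prod_pos fun i _ => ?_) (h.2 (1 / 2) ⟨by norm_num, by norm_num⟩)
  have : |1 / 2 - x i| ≤ 1 / 2 := abs_le.2 ⟨by linarith [(hx i).2], by linarith [(hx i).1]⟩
  unfold util
  linarith

theorem nash_eq_util_mul_prod {n : ℕ} (y : ℝ) (x : Fin n → ℝ) (i : Fin n) :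
    nash y x = util y (x i) * ∏ j ∈ Finset.univ.erase i, util y (x j) :=
  (Finset.mul_prod_erase _ _ (Finset.mem_univ i)).symm

theorem nash_update {n : ℕ} (y : ℝ) (x : Fin n → ℝ) (i : Fin n) (w : ℝ) :
    nash y (Function.update x i w) =
      util y w * ∏ j ∈ Finset.univ.erase i, util y (x j) := by
  rw [nash_eq_util_mul_prod y _ i, Function.update_self]
  congr 1
  refine Finset.prod_congr rfl fun j hj => ?_
  rw [Function.update_of_ne (Finset.ne_of_mem_erase hj)]

theorem nashFL_monotone_left_shift (n : ℕ) (x : Fin n → ℝ)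
    (hx : ∀ i, x i ∈ Set.Icc (0 : ℝ) 1) (i : Fin n) (c : ℝ)
    (hc₁ : 0 < c) (hc₂ : c ≤ x i)
    (ystar ystar' : ℝ)
    (hy : isNashOpt x ystar)
    (hy' : isNashOpt (Function.update x i (x i - c)) ystar') :
    ystar' ≤ ystar := by
  by_contra! hlt
  have hw : x i - c ∈ Set.Icc (0 : ℝ) 1 := ⟨by linarith, by linarith [(hx i).2]⟩
  have hx' : ∀ j, Function.update x i (x i - c) j ∈ Set.Icc (0 : ℝ) 1 := fun j => by
    rcases eq_or_ne j i with rfl | hj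
    · rwa [Function.update_self]
    · rw [Function.update_of_ne hj]
      exact hx j
  have hpos := hy.nash_pos hx
  have hpos' := hy'.nash_pos hx'
  have hle := hy.2 _ hy'.1
  have hle' := hy'.2 _ hy.1
  rw [nash_update] at hpos'
  rw [nash_update, nash_update] at hle'
  rw [nash_eq_util_mul_prod _ x i] at hpos
  rw [nash_eq_util_mul_prod _ x i, nash_eq_util_mul_prod _ x i] at hle
  have hP := pos_of_mul_pos_right hpos (util_nonneg hy.1 (hx i))
  have hQ := pos_of_mul_pos_right hpos' (util_nonneg hy'.1 hw)
  have hutil := util_mul_util_lt hy.1.1 hlt hy'.1.2 hw.1 (by linarith : x i - c < x i) (hx i).2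
  have hprod := mul_le_mul hle hle' (mul_nonneg (util_nonneg hy.1 hw) hP.le) hpos.le
  have hstrict := mul_lt_mul_of_pos_right hutil (mul_pos hP hQ)
  linarith
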